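/- arXiv:2211.15314 — 2 statements merged into one kernel-verified Lean document; each statement's English description precedes it below -/
import Mathlib

section
/- Let n_1 ≥ 4 be an even integer and let n = 2·n_1 + 4. Let Ḡ be the simple graph on vertex set S ∪ S̄, where S = {v_{2,1}, ..., v_{2,n_1+2}} and S̄ = {v_{3,1}, ..., v_{3,n_1+2}}, whose edge set consists of: all pairs within S except the matching pairs {v_{2,2t−1}, v_{2,2t}} for t = 1, ..., (n_1+2)/2; all pairs within S̄ except the matching pairs {v_{3,2t−1}, v_{3,2t}}; together with the edges of the cycle v_{2,1} v_{3,1} v_{2,2} v_{3,2} ... v_{2,n_1+2} v_{3,n_1+2} v_{2,1} of length 2n_1 + 4 alternating between S and S̄. Then the third largest eigenvalue of the signless Laplacian of Ḡ satisfies q_3(Ḡ) < n_1 + 4. -/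
open Finset

/-- The graph `Ḡ` on vertex set `S ∪ S̄` where `S = {0} × Fin m` (the vertices
`v_{2,1}, …, v_{2,m}`) and `S̄ = {1} × Fin m` (the vertices `v_{3,1}, …, v_{3,m}`),
with `m = n₁ + 2`: within each side all pairs are joined except the matching pairs
`{v_{·,2t-1}, v_{·,2t}}` (0-indexed: pairs with equal `val / 2`), together with the
edges of the alternating cycle `v_{2,1} v_{3,1} v_{2,2} v_{3,2} ⋯ v_{2,m} v_{3,m} v_{2,1}`. -/
def barG (m : ℕ) : SimpleGraph (Fin 2 × Fin m) :=
  SimpleGraph.fromRel fun x y =>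
    (x.1 = y.1 ∧ x.2.val / 2 ≠ y.2.val / 2) ∨
    (x.1 = 0 ∧ y.1 = 1 ∧ (x.2 = y.2 ∨ x.2.val = (y.2.val + 1) % m))

instance (m : ℕ) : DecidableRel (barG m).Adj := fun x y =>
  decidable_of_iff _ (SimpleGraph.fromRel_adj _ x y).symm

/-- The signless Laplacian matrix `Q(G) = D(G) + A(G)`. -/
def signlessLap {m : ℕ} (G : SimpleGraph (Fin 2 × Fin m)) [DecidableRel G.Adj] :
    Matrix (Fin 2 × Fin m) (Fin 2 × Fin m) ℝ :=
  Matrix.diagonal (fun v => (G.degree v : ℝ)) + G.adjMatrix ℝ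

open Matrix

/-- If the quadratic form of a real symmetric matrix is `< c ‖w‖²` on the nonzero vectors of the
kernel of a linear map to `ℝ^k`, then at most `k` of its eigenvalues are `≥ c`. -/
theorem ncard_le_eigenvalues_le {ι : Type*} [Fintype ι] [DecidableEq ι] {A : Matrix ι ι ℝ}
    (hA : A.IsHermitian) {k : ℕ} (f : (ι → ℝ) →ₗ[ℝ] (Fin k → ℝ)) (c : ℝ)
    (hf : ∀ w : ι → ℝ, w ≠ 0 → f w = 0 → w ⬝ᵥ (A *ᵥ w) < c * (w ⬝ᵥ w)) :
    {i | c ≤ hA.eigenvalues i}.ncard ≤ k := by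
  by_contra! hcard
  set T : Finset ι := {i | c ≤ hA.eigenvalues i} with hT
  have hTcard : k < Fintype.card T := by
    rw [Fintype.card_coe, ← Set.ncard_coe_finset]
    simpa [hT] using hcard
  let u : T → ι → ℝ := fun i => (hA.eigenvectorBasis i).ofLp
  have huu (p q : T → ℝ) : (∑ i, p i • u i) ⬝ᵥ (∑ i, q i • u i) = ∑ i, p i * q i := by
    have h := (hA.eigenvectorBasis.orthonormal.comp ((↑) : T → ι)
      Subtype.val_injective).inner_sum q p univ
    rw [EuclideanSpace.inner_eq_star_dotProduct] at h
    simpa [u, mul_comm] using h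
  obtain ⟨p, hp, hp0⟩ := (Submodule.ne_bot_iff _).1 <|
    LinearMap.ker_ne_bot_of_finrank_lt (f := f ∘ₗ Fintype.linearCombination ℝ u)
      (by simpa using hTcard)
  set w : ι → ℝ := ∑ i, p i • u i with hw
  have hAw : A *ᵥ w = ∑ i, (p i * hA.eigenvalues i) • u i := by
    simp only [hw, Matrix.mulVec_sum, Matrix.mulVec_smul, u, hA.mulVec_eigenvectorBasis, smul_smul]
  have hw0 : w ≠ 0 := by
    intro h
    have h2 := huu p p
    rw [← hw, h, zero_dotProduct] at h2
    refine hp0 (funext fun i => ?_)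
    have := (Finset.sum_eq_zero_iff_of_nonneg fun i _ => mul_self_nonneg (p i)).1 h2.symm i
      (mem_univ i)
    simpa using this
  have hlt := hf w hw0 (by
    rwa [LinearMap.mem_ker, LinearMap.comp_apply, Fintype.linearCombination_apply] at hp)
  rw [hAw, hw, huu, huu, Finset.mul_sum] at hlt
  refine hlt.not_ge (Finset.sum_le_sum fun i _ => ?_)
  have hi : c ≤ hA.eigenvalues i := (mem_filter.1 i.2).2
  nlinarith [mul_self_nonneg (p i)]

/-- The involution of `Fin m`, `m` even, exchanging `2t` and `2t + 1`. -/
def matchingPartner {m : ℕ} (hm : Even m) (i : Fin m) : Fin m :=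
  ⟨if i.val % 2 = 0 then i.val + 1 else i.val - 1, by
    have := i.2
    rw [Nat.even_iff] at hm
    split_ifs <;> omega⟩

theorem matchingPartner_involutive {m : ℕ} (hm : Even m) :
    Function.Involutive (matchingPartner hm) := by
  intro i
  ext
  simp only [matchingPartner]
  split_ifs <;> omega

theorem sum_comp_matchingPartner {m : ℕ} (hm : Even m) (x : Fin m → ℝ) :
    ∑ i, x (matchingPartner hm i) = ∑ i, x i :=
  Equiv.sum_comp (matchingPartner_involutive hm).toPerm x

theorem barG_adj_same {m : ℕ} (hm : Even m) (a : Fin 2) (i j : Fin m) :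
    (barG m).Adj (a, i) (a, j) ↔ ¬ (j = i ∨ j = matchingPartner hm i) := by
  have := i.2
  have := j.2
  rw [Nat.even_iff] at hm
  simp only [barG, SimpleGraph.fromRel_adj, Fin.ext_iff, matchingPartner, Prod.ext_iff, ne_eq]
  split_ifs <;> fin_cases a <;> simp <;> omega

theorem barG_adj_zero_one {n : ℕ} (i j : Fin (n + 2)) :
    (barG (n + 2)).Adj (0, i) (1, j) ↔ i = j ∨ i = j + 1 := by
  have h : i = j + 1 ↔ i.val = (j.val + 1) % (n + 2) := by
    rw [Fin.ext_iff, Fin.val_add, Fin.val_one]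
  simp [barG, h]

theorem barG_adjMatrix_same {m : ℕ} (hm : Even m) (a : Fin 2) (i j : Fin m) :
    (barG m).adjMatrix ℝ (a, i) (a, j) =
      1 - (if j = i then 1 else 0) - (if j = matchingPartner hm i then 1 else 0) := by
  have hne : i ≠ matchingPartner hm i := by
    simp only [matchingPartner, Fin.ext_iff, ne_eq]
    split_ifs <;> omega
  rw [SimpleGraph.adjMatrix_apply]
  simp only [barG_adj_same hm]
  by_cases h1 : j = i
  · subst h1; simp [hne]
  · by_cases h2 : j = matchingPartner hm i <;> simp [h1, h2]
    intro h; exact absurd h.symm hne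

theorem barG_adjMatrix_zero_one {n : ℕ} (i j : Fin (n + 2)) :
    (barG (n + 2)).adjMatrix ℝ (0, i) (1, j) =
      (if i = j then 1 else 0) + (if i = j + 1 then 1 else 0) := by
  rw [SimpleGraph.adjMatrix_apply]
  simp only [barG_adj_zero_one]
  by_cases h1 : i = j
  · subst h1; simp
  · simp [h1]

theorem barG_adjMatrix_mulVec_zero {n : ℕ} (hm : Even (n + 2)) (w : Fin 2 × Fin (n + 2) → ℝ)
    (i : Fin (n + 2)) :
    ((barG (n + 2)).adjMatrix ℝ *ᵥ w) (0, i) =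
      ∑ j, w (0, j) - w (0, i) - w (0, matchingPartner hm i) + (w (1, i) + w (1, i - 1)) := by
  have h (j : Fin (n + 2)) : i = j + 1 ↔ i - 1 = j := sub_eq_iff_eq_add.symm
  simp only [Matrix.mulVec, dotProduct, Fintype.sum_prod_type, Fin.sum_univ_two,
    barG_adjMatrix_same hm, barG_adjMatrix_zero_one, h]
  simp [sub_mul, add_mul, Finset.sum_add_distrib, Finset.sum_sub_distrib]

theorem barG_adjMatrix_mulVec_one {n : ℕ} (hm : Even (n + 2)) (w : Fin 2 × Fin (n + 2) → ℝ)
    (i : Fin (n + 2)) :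
    ((barG (n + 2)).adjMatrix ℝ *ᵥ w) (1, i) =
      ∑ j, w (1, j) - w (1, i) - w (1, matchingPartner hm i) + (w (0, i) + w (0, i + 1)) := by
  have h (j : Fin (n + 2)) : (barG (n + 2)).adjMatrix ℝ (1, i) (0, j) =
      (if j = i then 1 else 0) + (if j = i + 1 then 1 else 0) := by
    rw [← barG_adjMatrix_zero_one, SimpleGraph.adjMatrix_apply, SimpleGraph.adjMatrix_apply]
    simp only [SimpleGraph.adj_comm]
  simp only [Matrix.mulVec, dotProduct, Fintype.sum_prod_type, Fin.sum_univ_two,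
    barG_adjMatrix_same hm, h]
  simp [sub_mul, add_mul, Finset.sum_add_distrib, Finset.sum_sub_distrib]
  ring

theorem barG_degree {n : ℕ} (hm : Even (n + 2)) (v : Fin 2 × Fin (n + 2)) :
    ((barG (n + 2)).degree v : ℝ) = n + 2 := by
  have h := SimpleGraph.adjMatrix_mulVec_const_apply (α := ℝ) (G := barG (n + 2)) (a := 1) (v := v)
  rw [mul_one] at h
  rw [← h]
  obtain ⟨a, i⟩ := v
  fin_cases a
  · refine (barG_adjMatrix_mulVec_zero hm _ i).trans ?_
    simp
  · refine (barG_adjMatrix_mulVec_one hm _ i).trans ?_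
    simp

theorem sum_mul_add_matchingPartner_nonneg {m : ℕ} (hm : Even m) (x : Fin m → ℝ) :
    0 ≤ ∑ i, x i * (x i + x (matchingPartner hm i)) := by
  have h1 : 0 ≤ ∑ i, (x i + x (matchingPartner hm i)) ^ 2 := by positivity
  have h2 : ∑ i, (x i + x (matchingPartner hm i)) ^ 2 =
      ∑ i, x i * (x i + x (matchingPartner hm i)) + ∑ i, x i * (x i + x (matchingPartner hm i))
        + (∑ i, x (matchingPartner hm i) ^ 2 - ∑ i, x i ^ 2) := by
    rw [← Finset.sum_sub_distrib, ← Finset.sum_add_distrib, ← Finset.sum_add_distrib]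
    exact Finset.sum_congr rfl fun i _ => by ring
  rw [sum_comp_matchingPartner hm fun i => x i ^ 2] at h2
  linarith

/-- Strict bound for the quadratic form of an even cycle off the constant vectors. -/
theorem two_mul_cycle_form_lt {n : ℕ} {x y : Fin (n + 2) → ℝ} (hx : ∑ i, x i = 0)
    (hxy : x ≠ 0 ∨ y ≠ 0) :
    ∑ j, y j * (x j + x (j + 1)) < ∑ j, x j ^ 2 + ∑ j, y j ^ 2 := by
  by_contra! h
  have hshift : ∑ j, x (j + 1) ^ 2 = ∑ j, x j ^ 2 :=
    Equiv.sum_comp (Equiv.addRight (1 : Fin (n + 2))) fun j => x j ^ 2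
  have hsq : ∑ j, ((x j - y j) ^ 2 + (x (j + 1) - y j) ^ 2) =
      2 * (∑ j, y j ^ 2 - ∑ j, y j * (x j + x (j + 1))) + ∑ j, x j ^ 2 + ∑ j, x (j + 1) ^ 2 := by
    rw [← Finset.sum_sub_distrib, Finset.mul_sum, ← Finset.sum_add_distrib,
      ← Finset.sum_add_distrib]
    exact Finset.sum_congr rfl fun j _ => by ring
  have hnonneg : ∀ j ∈ univ, 0 ≤ (x j - y j) ^ 2 + (x (j + 1) - y j) ^ 2 :=
    fun j _ => by positivity
  have hz := (Finset.sum_eq_zero_iff_of_nonneg hnonneg).1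
    (le_antisymm (by linarith) (Finset.sum_nonneg hnonneg))
  have h1 (j) : x j = y j := by nlinarith [hz j (mem_univ j), sq_nonneg (x (j + 1) - y j)]
  have h2 (j) : x (j + 1) = y j := by nlinarith [hz j (mem_univ j), sq_nonneg (x j - y j)]
  have hconst (j) : x j = x 0 := by
    induction j using Fin.induction with
    | zero => rfl
    | succ i ih => rw [← Fin.coeSucc_eq_succ, h2, ← h1, ih]
  have h0 : x 0 = 0 := by
    simp only [hconst, Finset.sum_const, card_univ, Fintype.card_fin, nsmul_eq_mul] at hx
    exact (mul_eq_zero.1 hx).resolve_left (by positivity)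
  have hx0 : x = 0 := funext fun j => (hconst j).trans h0
  exact hxy.elim (· hx0) (· (funext fun j => by rw [← h1, hx0]))

theorem signlessLap_barG_form_lt {n : ℕ} (hm : Even (n + 2)) {w : Fin 2 × Fin (n + 2) → ℝ}
    (hw : w ≠ 0) (h0 : ∑ i, w (0, i) = 0) (h1 : ∑ i, w (1, i) = 0) :
    w ⬝ᵥ (signlessLap (barG (n + 2)) *ᵥ w) < (n + 4) * (w ⬝ᵥ w) := by
  have hxy : (fun i => w (0, i)) ≠ 0 ∨ (fun i => w (1, i)) ≠ 0 := by
    by_contra! h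
    refine hw (funext fun ⟨a, i⟩ => ?_)
    fin_cases a
    · exact congrFun h.1 i
    · exact congrFun h.2 i
  have hcycle := two_mul_cycle_form_lt h0 hxy
  have hP0 := sum_mul_add_matchingPartner_nonneg hm fun i => w (0, i)
  have hP1 := sum_mul_add_matchingPartner_nonneg hm fun i => w (1, i)
  have hshift : ∑ i, w (0, i + 1) * w (1, i) = ∑ i, w (0, i) * w (1, i - 1) := by
    rw [← Equiv.sum_comp (Equiv.addRight (1 : Fin (n + 2))) fun i => w (0, i) * w (1, i - 1)]
    simp
  have hQ : w ⬝ᵥ (signlessLap (barG (n + 2)) *ᵥ w) =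
      (n + 2) * (w ⬝ᵥ w) + w ⬝ᵥ ((barG (n + 2)).adjMatrix ℝ *ᵥ w) := by
    simp only [signlessLap, Matrix.add_mulVec, dotProduct_add, barG_degree hm]
    congr 1
    simp only [dotProduct, Matrix.mulVec_diagonal, Finset.mul_sum]
    exact Finset.sum_congr rfl fun v _ => by ring
  rw [hQ]
  simp only [dotProduct, Fintype.sum_prod_type, Fin.sum_univ_two, barG_adjMatrix_mulVec_zero hm,
    barG_adjMatrix_mulVec_one hm, h0, h1]
  simp only [mul_add, mul_sub, Finset.sum_add_distrib, Finset.sum_sub_distrib, mul_zero,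
    Finset.sum_const_zero, pow_two, mul_comm (w (1, _)) (w (0, _))] at hcycle hP0 hP1 hshift ⊢
  linarith

/-- The third largest signless Laplacian eigenvalue of `Ḡ` is `< n₁ + 4`;
equivalently, at most two of the `2n₁ + 4` eigenvalues (with multiplicity)
are `≥ n₁ + 4`. -/
theorem stmt_18 (n1 : ℕ) (hn1 : 4 ≤ n1) (heven : Even n1)
    (hQ : (signlessLap (barG (n1 + 2))).IsHermitian) :
    {i : Fin 2 × Fin (n1 + 2) | ((n1 : ℝ) + 4) ≤ hQ.eigenvalues i}.ncard ≤ 2 := by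
  exact ncard_le_eigenvalues_le hQ (k := 2)
    (LinearMap.pi fun a => ∑ i, LinearMap.proj (a, i)) ((n1 : ℝ) + 4) fun w hw hker =>
      signlessLap_barG_form_lt (heven.add even_two) hw
        (by simpa using congrFun hker 0) (by simpa using congrFun hker 1)
end

section
/- Let k ≥ 3 and r ≥ k + 4 be integers, and let n = k·r. Let G be the simple graph on vertex set S_1 ∪ ... ∪ S_k, where S_i = {v_{1,i}, ..., v_{r,i}}, whose edges are: within each S_i, exactly the edges of the cycle v_{1,i} v_{2,i} ... v_{r,i} v_{1,i}; and all pairs of vertices lying in distinct parts S_i, S_j (so G is the complement of the disjoint union of k copies of K_r minus a Hamiltonian cycle). Let G' be obtained from G by deleting all k² edges {v_{1,i}, v_{r,j}} for i, j ∈ {1,...,k} (the edges of a complete bipartite graph K_{k,k} with parts {v_{1,1},...,v_{1,k}} and {v_{r,1},...,v_{r,k}}). Then the smallest adjacency eigenvalue of G' equals 2 − r, and the maximum k-cut of G' attains the adjacency eigenvalue bound with equality: mc_k(G') = ((k−1)/k)·(m' − n·(2 − r)/2), where m' is the number of edges of G'. -/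
open Finset

/-- The maximum `k`-cut of `G`: the maximum, over all partitions of the vertex set
into `k` (possibly empty) parts, of the number of edges joining distinct parts. -/
def maxKCut {V : Type*} [Fintype V] [DecidableEq V]
    (G : SimpleGraph V) [DecidableRel G.Adj] (k : ℕ) : ℕ :=
  Finset.univ.sup fun f : V → Fin k =>
    (G.edgeFinset.filter fun e => ¬ (e.map f).IsDiag).card

/-- The graph `G' = complement of (k copies of (K_r minus a Hamilton cycle)) minus the
edges of a `K_{k,k}`.  The vertex `v_{t,i}` is `(i, t-1) : Fin k × Fin r`; the part
`S_i` is `{i} × Fin r`.  Within each part the edges are exactly those of the cycle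
`v_{1,i} v_{2,i} ⋯ v_{r,i} v_{1,i}`; any two vertices in distinct parts are adjacent;
and then all k² edges `{v_{1,i}, v_{r,j}}` (i.e. between second coordinates `0` and
`r - 1`) are deleted. -/
def Gprime (k r : ℕ) : SimpleGraph (Fin k × Fin r) :=
  SimpleGraph.fromRel fun x y =>
    ((x.1 = y.1 ∧ (x.2.val + 1) % r = y.2.val) ∨ x.1 ≠ y.1) ∧
    ¬((x.2.val = 0 ∧ y.2.val = r - 1) ∨ (x.2.val = r - 1 ∧ y.2.val = 0))

instance (k r : ℕ) : DecidableRel (Gprime k r).Adj := fun x y =>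
  decidable_of_iff _ (SimpleGraph.fromRel_adj _ x y).symm

/-- Twice the size of a cut is the sum of the adjacency entries across the cut. -/
lemma two_mul_card_cut {V W : Type*} [Fintype V] [DecidableEq V] [DecidableEq W]
    (G : SimpleGraph V) [DecidableRel G.Adj] (f : V → W) :
    2 * ((G.edgeFinset.filter fun e => ¬ (e.map f).IsDiag).card : ℝ) =
      ∑ x, ∑ y, G.adjMatrix ℝ x y * (if f x = f y then 0 else 1) := by
  classical
  let H : SimpleGraph V :=
    { Adj := fun x y => G.Adj x y ∧ f x ≠ f y
      symm := ⟨fun x y h => ⟨h.1.symm, h.2.symm⟩⟩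
      loopless := ⟨fun x h => h.2 rfl⟩ }
  have hH : (G.edgeFinset.filter fun e => ¬ (e.map f).IsDiag) = H.edgeFinset := by
    ext e
    induction e with
    | h x y => simp [H]
  rw [hH]
  have h := H.sum_degrees_eq_twice_card_edges
  have h' : (2 * (H.edgeFinset.card : ℝ)) = ∑ x, (H.degree x : ℝ) := by exact_mod_cast h.symm
  rw [h']
  refine Finset.sum_congr rfl fun x _ => ?_
  rw [← SimpleGraph.card_neighborFinset_eq_degree, SimpleGraph.neighborFinset_eq_filter,
    Finset.card_filter]
  push_cast
  refine Finset.sum_congr rfl fun y _ => ?_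
  by_cases h1 : G.Adj x y <;> by_cases h2 : f x = f y <;> simp [H, SimpleGraph.adjMatrix, h1, h2]

/-- Twice the number of edges is the sum of the adjacency entries. -/
lemma two_mul_card_edgeFinset {V : Type*} [Fintype V] [DecidableEq V]
    (G : SimpleGraph V) [DecidableRel G.Adj] :
    2 * (G.edgeFinset.card : ℝ) = ∑ x, ∑ y, G.adjMatrix ℝ x y := by
  have h := G.sum_degrees_eq_twice_card_edges
  have h' : (2 * (G.edgeFinset.card : ℝ)) = ∑ x, (G.degree x : ℝ) := by exact_mod_cast h.symm
  rw [h']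
  refine Finset.sum_congr rfl fun x _ => ?_
  rw [← SimpleGraph.card_neighborFinset_eq_degree, SimpleGraph.neighborFinset_eq_filter,
    Finset.card_filter]
  push_cast
  rfl

/-- The centred indicator vector of a colour class. -/
noncomputable def centredIndicator {V : Type*} {k : ℕ} (f : V → Fin k) (c : Fin k) (x : V) : ℝ :=
  (if f x = c then 1 else 0) - 1 / k

lemma sum_centredIndicator_mul {V : Type*} {k : ℕ} (hk : k ≠ 0) (f : V → Fin k) (x y : V) :
    ∑ c, centredIndicator f c x * centredIndicator f c y =
      (if f x = f y then 1 else 0) - 1 / (k : ℝ) := by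
  have hk' : (k : ℝ) ≠ 0 := by exact_mod_cast hk
  have h : ∀ c, centredIndicator f c x * centredIndicator f c y =
      (if f x = c then (if f y = c then 1 else 0) else 0) - (if f x = c then 1 / (k : ℝ) else 0)
        - (if f y = c then 1 / (k : ℝ) else 0) + 1 / (k : ℝ) * (1 / k) := by
    intro c
    unfold centredIndicator
    split_ifs <;> ring
  simp only [h, Finset.sum_add_distrib, Finset.sum_sub_distrib, Finset.sum_ite_eq,
    Finset.sum_ite_eq', Finset.mem_univ, if_true, Finset.sum_const, Finset.card_univ,
    Fintype.card_fin, nsmul_eq_mul, eq_comm (a := f y)]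
  field_simp
  ring

/-- The size of a `k`-cut in terms of the quadratic form of the adjacency matrix. -/
lemma card_cut_eq {V : Type*} [Fintype V] [DecidableEq V] {k : ℕ} (hk : k ≠ 0)
    (G : SimpleGraph V) [DecidableRel G.Adj] (f : V → Fin k) :
    ((G.edgeFinset.filter fun e => ¬ (e.map f).IsDiag).card : ℝ) =
      (1 - 1 / (k : ℝ)) * G.edgeFinset.card -
        (∑ c, ∑ x, ∑ y, G.adjMatrix ℝ x y *
          (centredIndicator f c x * centredIndicator f c y)) / 2 := by
  have h1 := two_mul_card_cut G f
  have h2 := two_mul_card_edgeFinset G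
  have h3 : ∑ c, ∑ x, ∑ y, G.adjMatrix ℝ x y *
      (centredIndicator f c x * centredIndicator f c y) =
      (1 - 1 / (k : ℝ)) * (∑ x, ∑ y, G.adjMatrix ℝ x y) -
        ∑ x, ∑ y, G.adjMatrix ℝ x y * (if f x = f y then 0 else 1) := by
    rw [Finset.sum_comm, Finset.mul_sum, ← Finset.sum_sub_distrib]
    refine Finset.sum_congr rfl fun x _ => ?_
    rw [Finset.sum_comm, Finset.mul_sum, ← Finset.sum_sub_distrib]
    refine Finset.sum_congr rfl fun y _ => ?_
    rw [← Finset.mul_sum, sum_centredIndicator_mul hk]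
    split_ifs <;> ring
  rw [h3, ← h1, ← h2]
  ring

lemma sum_sum_centredIndicator_sq {V : Type*} [Fintype V] {k : ℕ} (hk : k ≠ 0) (f : V → Fin k) :
    ∑ c, ∑ x, centredIndicator f c x ^ 2 = Fintype.card V * (1 - 1 / (k : ℝ)) := by
  rw [Finset.sum_comm]
  simp only [sq, sum_centredIndicator_mul hk]
  simp
  ring

lemma sum_sq_eq_sum_centred_sq {k : ℕ} (hk : k ≠ 0) (a : Fin k → ℝ) :
    ∑ i, a i ^ 2 = ∑ i, (a i - (∑ j, a j) / k) ^ 2 + (∑ j, a j) ^ 2 / k := by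
  have hk' : (k : ℝ) ≠ 0 := by exact_mod_cast hk
  simp only [sub_sq, Finset.sum_add_distrib, Finset.sum_sub_distrib, ← Finset.sum_mul,
    ← Finset.mul_sum, Finset.sum_const, Finset.card_univ, Fintype.card_fin, nsmul_eq_mul]
  field_simp
  ring

lemma sum_add_one {m : ℕ} (x : Fin (m + 1) → ℝ) : ∑ t, x (t + 1) = ∑ t, x t :=
  Equiv.sum_comp (Equiv.addRight (1 : Fin (m + 1))) x

/-- The quadratic form of `C - J + (r - 2) I` is nonnegative, where `C` is the adjacency matrix
of the cycle on `r` vertices and `J` is the all-ones matrix. -/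
lemma cycle_form_nonneg {m : ℕ} (hm : 3 ≤ m) (x : Fin (m + 1) → ℝ) :
    0 ≤ ∑ t, (x t + x (t + 1)) ^ 2 + ((m : ℝ) - 3) * ∑ t, x t ^ 2 - (∑ t, x t) ^ 2 := by
  have h1 := sq_sum_le_card_mul_sum_sq (s := Finset.univ) (f := fun t => x t + x (t + 1))
  have h2 := sq_sum_le_card_mul_sum_sq (s := Finset.univ) (f := x)
  rw [Finset.sum_add_distrib, sum_add_one] at h1
  simp only [Finset.card_univ, Fintype.card_fin] at h1 h2
  push_cast at h1 h2
  have hm' : (3 : ℝ) ≤ m := by exact_mod_cast hm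
  have h3 := mul_le_mul_of_nonneg_left h2 (sub_nonneg.2 hm')
  refine nonneg_of_mul_nonneg_right (a := (m : ℝ) + 1) ?_ (by positivity)
  nlinarith

lemma adjMatrix_Gprime_apply {k m : ℕ} (hm : 2 ≤ m) (i j : Fin k) (s t : Fin (m + 1)) :
    (Gprime k (m + 1)).adjMatrix ℝ (i, s) (j, t) =
      1 - ((if s = 0 then 1 else 0) * (if t = Fin.last m then 1 else 0) +
          (if s = Fin.last m then 1 else 0) * (if t = 0 then 1 else 0)) +
        (if i = j then (if t = s + 1 then 1 else 0) + (if s = t + 1 then 1 else 0) - 1 else 0) := by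
  have hsucc : ∀ a b : Fin (m + 1), b = a + 1 ↔ (a.val + 1) % (m + 1) = b.val := by
    intro a b
    rw [Fin.ext_iff, Fin.val_add, Fin.val_one', Nat.add_mod_mod]
    exact eq_comm
  have hmod : ∀ a : Fin (m + 1), (a.val = m ∧ (a.val + 1) % (m + 1) = 0) ∨
      (a.val < m ∧ (a.val + 1) % (m + 1) = a.val + 1) := by
    intro a
    rcases (Nat.lt_succ_iff.1 a.2).lt_or_eq with h | h
    · exact Or.inr ⟨h, Nat.mod_eq_of_lt (by omega)⟩
    · exact Or.inl ⟨h, by rw [h, Nat.mod_self]⟩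
  simp only [SimpleGraph.adjMatrix_apply, Gprime, SimpleGraph.fromRel_adj, ne_eq, Prod.mk.injEq,
    hsucc, Fin.ext_iff, Fin.val_zero, Fin.val_last, Nat.add_sub_cancel]
  have hs := hmod s
  have ht := hmod t
  generalize (s.val + 1) % (m + 1) = s' at *
  generalize (t.val + 1) % (m + 1) = t' at *
  generalize s.val = a at *
  generalize t.val = b at *
  generalize i.val = p at *
  generalize j.val = q at *
  split_ifs <;> first | (exfalso; omega) | norm_num

/-- The quadratic form of the adjacency matrix of `Gprime`. -/
lemma quadraticForm_Gprime {k m : ℕ} (hm : 2 ≤ m) (v : Fin k × Fin (m + 1) → ℝ) :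
    ∑ x, ∑ y, (Gprime k (m + 1)).adjMatrix ℝ x y * (v x * v y) =
      (∑ t, ∑ i, v (i, t)) ^ 2 - 2 * (∑ i, v (i, 0)) * (∑ i, v (i, Fin.last m)) +
        ∑ i, (2 * ∑ t, v (i, t) * v (i, t + 1) - (∑ t, v (i, t)) ^ 2) := by
  have key : ∀ i s j t, (Gprime k (m + 1)).adjMatrix ℝ (i, s) (j, t) * (v (i, s) * v (j, t)) =
      v (i, s) * v (j, t)
      - (if s = 0 then v (i, s) else 0) * (if t = Fin.last m then v (j, t) else 0)
      - (if s = Fin.last m then v (i, s) else 0) * (if t = 0 then v (j, t) else 0)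
      + (if i = j then (if t = s + 1 then v (i, s) * v (j, t) else 0)
        + (if s = t + 1 then v (i, s) * v (j, t) else 0) - v (i, s) * v (j, t) else 0) := by
    intro i s j t
    rw [adjMatrix_Gprime_apply hm]
    split_ifs <;> ring
  simp only [Fintype.sum_prod_type, key, Finset.sum_add_distrib, Finset.sum_sub_distrib]
  have e1 : ∑ i : Fin k, ∑ s : Fin (m + 1), ∑ j : Fin k, ∑ t : Fin (m + 1), v (i, s) * v (j, t) =
      (∑ t, ∑ i, v (i, t)) ^ 2 := by
    rw [Finset.sum_comm (f := fun t i => v (i, t)), sq]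
    simp only [← Finset.mul_sum, ← Finset.sum_mul]
  have e2 : ∀ a b : Fin (m + 1), ∑ i : Fin k, ∑ s : Fin (m + 1), ∑ j : Fin k, ∑ t : Fin (m + 1),
      (if s = a then v (i, s) else 0) * (if t = b then v (j, t) else 0) =
      (∑ i, v (i, a)) * ∑ i, v (i, b) := by
    intro a b
    simp only [← Finset.mul_sum, ← Finset.sum_mul, Finset.sum_ite_eq', Finset.mem_univ, if_true]
  have e3 : ∑ i : Fin k, ∑ s : Fin (m + 1), ∑ j : Fin k, ∑ t : Fin (m + 1),
      (if i = j then (if t = s + 1 then v (i, s) * v (j, t) else 0)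
        + (if s = t + 1 then v (i, s) * v (j, t) else 0) - v (i, s) * v (j, t) else 0) =
      ∑ i, (2 * ∑ t, v (i, t) * v (i, t + 1) - (∑ t, v (i, t)) ^ 2) := by
    refine Finset.sum_congr rfl fun i _ => ?_
    have : ∀ s : Fin (m + 1), ∑ j : Fin k, ∑ t : Fin (m + 1),
        (if i = j then (if t = s + 1 then v (i, s) * v (j, t) else 0)
        + (if s = t + 1 then v (i, s) * v (j, t) else 0) - v (i, s) * v (j, t) else 0) =
        ∑ t : Fin (m + 1), ((if t = s + 1 then v (i, s) * v (i, t) else 0)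
        + (if s = t + 1 then v (i, s) * v (i, t) else 0) - v (i, s) * v (i, t)) := by
      intro s
      rw [Finset.sum_comm]
      simp only [Finset.sum_ite_eq, Finset.mem_univ, if_true]
    simp only [this, Finset.sum_add_distrib, Finset.sum_sub_distrib]
    rw [Finset.sum_comm (f := fun s t => if s = t + 1 then v (i, s) * v (i, t) else 0)]
    simp only [Finset.sum_ite_eq', Finset.mem_univ, if_true, ← Finset.mul_sum, ← Finset.sum_mul]
    simp only [mul_comm (v (i, _ + 1))]
    ring
  rw [e1, e2, e2, e3, Finset.sum_sub_distrib]
  ring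

/-- The adjacency matrix of `Gprime` is bounded below by `2 - r`. -/
lemma quadraticForm_Gprime_ge {k m : ℕ} (hk : k ≠ 0) (hm : 3 ≤ m) (hkm : k + 3 ≤ m)
    (v : Fin k × Fin (m + 1) → ℝ) :
    (1 - (m : ℝ)) * ∑ x, v x ^ 2 ≤
      ∑ x, ∑ y, (Gprime k (m + 1)).adjMatrix ℝ x y * (v x * v y) := by
  have hkpos : (0 : ℝ) < k := by exact_mod_cast Nat.pos_of_ne_zero hk
  rw [quadraticForm_Gprime (by omega), Fintype.sum_prod_type]
  set X : Fin (m + 1) → ℝ := fun t => ∑ i, v (i, t) with hX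
  have hrow : ∀ i, 2 * ∑ t, v (i, t) * v (i, t + 1) =
      ∑ t, (v (i, t) + v (i, t + 1)) ^ 2 - 2 * ∑ t, v (i, t) ^ 2 := by
    intro i
    have := sum_add_one (fun t => v (i, t) ^ 2)
    simp only [add_sq, Finset.sum_add_distrib, this, mul_assoc, ← Finset.mul_sum]
    ring
  have hsum : 0 ≤ ∑ i, (∑ t, ((v (i, t) - X t / k) + (v (i, t + 1) - X (t + 1) / k)) ^ 2
      + ((m : ℝ) - 3) * ∑ t, (v (i, t) - X t / k) ^ 2 - (∑ t, (v (i, t) - X t / k)) ^ 2) :=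
    Finset.sum_nonneg fun i _ => cycle_form_nonneg hm fun t => v (i, t) - X t / k
  have d1 : ∑ i, ∑ t, ((v (i, t) - X t / k) + (v (i, t + 1) - X (t + 1) / k)) ^ 2 =
      ∑ i, ∑ t, (v (i, t) + v (i, t + 1)) ^ 2 - (∑ t, (X t + X (t + 1)) ^ 2) / k := by
    rw [Finset.sum_comm, Finset.sum_comm (f := fun i t => (v (i, t) + v (i, t + 1)) ^ 2),
      Finset.sum_div, ← Finset.sum_sub_distrib]
    refine Finset.sum_congr rfl fun t _ => ?_
    have h := sum_sq_eq_sum_centred_sq hk fun i => v (i, t) + v (i, t + 1)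
    rw [Finset.sum_add_distrib] at h
    rw [h, add_sub_cancel_right]
    refine Finset.sum_congr rfl fun i _ => ?_
    simp only [hX]
    ring
  have d2 : ∑ i, ∑ t, (v (i, t) - X t / k) ^ 2 =
      ∑ i, ∑ t, v (i, t) ^ 2 - (∑ t, X t ^ 2) / k := by
    rw [Finset.sum_comm, Finset.sum_comm (f := fun i t => v (i, t) ^ 2),
      Finset.sum_div, ← Finset.sum_sub_distrib]
    refine Finset.sum_congr rfl fun t _ => ?_
    rw [sum_sq_eq_sum_centred_sq hk fun i => v (i, t), add_sub_cancel_right]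
  have d3 : ∑ i, (∑ t, (v (i, t) - X t / k)) ^ 2 =
      ∑ i, (∑ t, v (i, t)) ^ 2 - (∑ t, X t) ^ 2 / k := by
    have h := sum_sq_eq_sum_centred_sq hk fun i => ∑ t, v (i, t)
    rw [Finset.sum_comm] at h
    rw [h, add_sub_cancel_right]
    simp only [Finset.sum_sub_distrib, ← Finset.sum_div]
    rfl
  rw [Finset.sum_sub_distrib, Finset.sum_add_distrib, ← Finset.mul_sum, d1, d2, d3] at hsum
  have hends : X 0 ^ 2 + X (Fin.last m) ^ 2 ≤ ∑ t, X t ^ 2 := by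
    have hne : (0 : Fin (m + 1)) ≠ Fin.last m := by
      rw [Ne, Fin.ext_iff, Fin.val_zero, Fin.val_last]
      omega
    rw [← Finset.sum_pair (f := fun t => X t ^ 2) hne]
    exact Finset.sum_le_sum_of_subset_of_nonneg (Finset.subset_univ _) fun _ _ _ => sq_nonneg _
  have hC : 0 ≤ ∑ t, (X t + X (t + 1)) ^ 2 := Finset.sum_nonneg fun _ _ => sq_nonneg _
  have hkm' : (k : ℝ) + 3 ≤ m := by exact_mod_cast hkm
  have hk1 : (1 : ℝ) ≤ k := by exact_mod_cast Nat.one_le_iff_ne_zero.2 hk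
  have hmain : 0 ≤ (∑ t, X t) ^ 2 - 2 * X 0 * X (Fin.last m) + (∑ t, (X t + X (t + 1)) ^ 2) / k
      + ((m : ℝ) - 3) * ((∑ t, X t ^ 2) / k) - (∑ t, X t) ^ 2 / k := by
    have f1 : (∑ t, X t) ^ 2 / k ≤ (∑ t, X t) ^ 2 := div_le_self (sq_nonneg _) hk1
    have f2 : 0 ≤ (∑ t, (X t + X (t + 1)) ^ 2) / (k : ℝ) := div_nonneg hC hkpos.le
    have f3 : ∑ t, X t ^ 2 ≤ ((m : ℝ) - 3) * ((∑ t, X t ^ 2) / k) := by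
      rw [← mul_div_assoc, le_div_iff₀ hkpos, mul_comm]
      exact mul_le_mul_of_nonneg_right (by linarith)
        (Finset.sum_nonneg fun _ _ => sq_nonneg _)
    nlinarith [sq_nonneg (X 0 - X (Fin.last m))]
  simp only [hrow, Finset.sum_sub_distrib, ← Finset.mul_sum]
  linarith

/-- Vectors constant on the parts with coordinate sum zero are eigenvectors of `Gprime`. -/
lemma adjMatrix_Gprime_mulVec {k m : ℕ} (hm : 2 ≤ m) (u : Fin k → ℝ) (hu : ∑ i, u i = 0) :
    ((Gprime k (m + 1)).adjMatrix ℝ).mulVec (fun x => u x.1) =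
      (1 - (m : ℝ)) • fun x => u x.1 := by
  ext ⟨i, s⟩
  have hprod : ∀ t j, (Gprime k (m + 1)).adjMatrix ℝ (i, s) (j, t) * u j =
      (1 - ((if s = 0 then 1 else 0) * (if t = Fin.last m then 1 else 0) +
        (if s = Fin.last m then 1 else 0) * (if t = 0 then 1 else 0))) * u j +
      (if i = j then
        ((if t = s + 1 then 1 else 0) + (if t = s - 1 then 1 else 0) - 1) * u j else 0) := by
    intro t j
    rw [adjMatrix_Gprime_apply hm, add_mul, ite_mul (i = j), zero_mul]
    simp only [eq_sub_iff_add_eq, eq_comm (a := s) (b := t + 1)]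
  have hinner : ∀ t, ∑ j, (Gprime k (m + 1)).adjMatrix ℝ (i, s) (j, t) * u j =
      ((if t = s + 1 then 1 else 0) + (if t = s - 1 then 1 else 0) - 1) * u i := by
    intro t
    rw [Finset.sum_congr rfl fun j _ => hprod t j, Finset.sum_add_distrib, ← Finset.mul_sum, hu,
      mul_zero, zero_add, Finset.sum_ite_eq, if_pos (Finset.mem_univ i)]
  simp only [Matrix.mulVec, dotProduct, Fintype.sum_prod_type_right, hinner, Pi.smul_apply,
    smul_eq_mul]
  rw [← Finset.sum_mul, Finset.sum_sub_distrib, Finset.sum_add_distrib]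
  simp only [Finset.sum_ite_eq', Finset.mem_univ, if_true, Finset.sum_const,
    Finset.card_univ, Fintype.card_fin, nsmul_eq_mul]
  push_cast
  ring

/-- The smallest adjacency eigenvalue of `Gprime`. -/
lemma inf_eigenvalues_Gprime {k m : ℕ} (hk : 2 ≤ k) (hkm : k + 3 ≤ m)
    (hA : ((Gprime k (m + 1)).adjMatrix ℝ).IsHermitian)
    (hne : (Finset.univ : Finset (Fin k × Fin (m + 1))).Nonempty) :
    Finset.univ.inf' hne hA.eigenvalues = 1 - (m : ℝ) := by
  apply le_antisymm
  · obtain ⟨u, hu, hu0⟩ : ∃ u : Fin k → ℝ, ∑ i, u i = 0 ∧ u ≠ 0 := by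
      refine ⟨Pi.single ⟨0, by omega⟩ 1 - Pi.single ⟨1, by omega⟩ 1, by simp, fun h => ?_⟩
      simpa [Pi.single_apply, Fin.ext_iff] using congrFun h ⟨0, by omega⟩
    have hmem : (1 - (m : ℝ)) ∈ spectrum ℝ ((Gprime k (m + 1)).adjMatrix ℝ) := by
      rw [← Matrix.spectrum_toLin', ← Module.End.hasEigenvalue_iff_mem_spectrum]
      refine Module.End.hasEigenvalue_of_hasEigenvector (x := fun x => u x.1) ⟨?_, fun h => ?_⟩
      · rw [Module.End.mem_eigenspace_iff, Matrix.toLin'_apply,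
          adjMatrix_Gprime_mulVec (by omega) u hu]
      · exact hu0 (funext fun i => congrFun h (i, 0))
    rw [hA.spectrum_real_eq_range_eigenvalues] at hmem
    obtain ⟨x, hx⟩ := hmem
    rw [← hx]
    exact Finset.inf'_le _ (Finset.mem_univ x)
  · refine Finset.le_inf' _ _ fun x _ => ?_
    have hmem : hA.eigenvalues x ∈ spectrum ℝ ((Gprime k (m + 1)).adjMatrix ℝ) := by
      rw [hA.spectrum_real_eq_range_eigenvalues]
      exact ⟨x, rfl⟩
    rw [← Matrix.spectrum_toLin', ← Module.End.hasEigenvalue_iff_mem_spectrum] at hmem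
    obtain ⟨v, hv, hv0⟩ := hmem.exists_hasEigenvector
    rw [Module.End.mem_eigenspace_iff, Matrix.toLin'_apply] at hv
    have hq := quadraticForm_Gprime_ge (by omega) (by omega) hkm v
    have hform : ∑ x, ∑ y, (Gprime k (m + 1)).adjMatrix ℝ x y * (v x * v y) =
        hA.eigenvalues x * ∑ x, v x ^ 2 := by
      rw [Finset.mul_sum]
      refine Finset.sum_congr rfl fun y _ => ?_
      have := congrFun hv y
      simp only [Matrix.mulVec, dotProduct, Pi.smul_apply, smul_eq_mul] at this
      rw [sq, ← mul_assoc, ← this, Finset.sum_mul]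
      exact Finset.sum_congr rfl fun z _ => by ring
    rw [hform] at hq
    refine le_of_mul_le_mul_right hq ?_
    obtain ⟨y, hy⟩ := Function.ne_iff.1 hv0
    exact Finset.sum_pos' (fun _ _ => sq_nonneg _) ⟨y, Finset.mem_univ y, by
      have : v y ≠ 0 := hy
      positivity⟩

/-- The maximum `k`-cut of `Gprime` attains the adjacency eigenvalue bound. -/
lemma maxKCut_Gprime {k m : ℕ} (hk : k ≠ 0) (hkm : k + 3 ≤ m) :
    (maxKCut (Gprime k (m + 1)) k : ℝ) =
      (1 - 1 / (k : ℝ)) * (((Gprime k (m + 1)).edgeFinset.card : ℝ)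
        - ((k : ℝ) * (m + 1)) * (1 - (m : ℝ)) / 2) := by
  have hk' : (k : ℝ) ≠ 0 := by exact_mod_cast hk
  have hcard : (Fintype.card (Fin k × Fin (m + 1)) : ℝ) = (k : ℝ) * (m + 1) := by simp
  have hupper : ∀ f : Fin k × Fin (m + 1) → Fin k,
      (((Gprime k (m + 1)).edgeFinset.filter fun e => ¬ (e.map f).IsDiag).card : ℝ) ≤
      (1 - 1 / (k : ℝ)) * (((Gprime k (m + 1)).edgeFinset.card : ℝ)
        - ((k : ℝ) * (m + 1)) * (1 - (m : ℝ)) / 2) := by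
    intro f
    have h := Finset.sum_le_sum fun c (_ : c ∈ (Finset.univ : Finset (Fin k))) =>
      quadraticForm_Gprime_ge hk (by omega) hkm (centredIndicator f c)
    rw [← Finset.mul_sum, sum_sum_centredIndicator_sq hk, hcard] at h
    rw [card_cut_eq hk]
    linarith
  have hattained : (((Gprime k (m + 1)).edgeFinset.filter
      fun e => ¬ (e.map (Prod.fst : Fin k × Fin (m + 1) → Fin k)).IsDiag).card : ℝ) =
      (1 - 1 / (k : ℝ)) * (((Gprime k (m + 1)).edgeFinset.card : ℝ)
        - ((k : ℝ) * (m + 1)) * (1 - (m : ℝ)) / 2) := by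
    have h : ∑ c, ∑ x, ∑ y, (Gprime k (m + 1)).adjMatrix ℝ x y *
        (centredIndicator Prod.fst c x * centredIndicator Prod.fst c y) =
        (1 - (m : ℝ)) * ∑ c, ∑ x : Fin k × Fin (m + 1),
          (centredIndicator Prod.fst c x : ℝ) ^ 2 := by
      rw [Finset.mul_sum]
      refine Finset.sum_congr rfl fun c _ => ?_
      rw [Finset.mul_sum]
      refine Finset.sum_congr rfl fun x _ => ?_
      have := congrFun (adjMatrix_Gprime_mulVec (k := k) (m := m) (by omega)
        (fun i => centredIndicator id c i) (by simp [centredIndicator, hk'])) x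
      simp only [Matrix.mulVec, dotProduct, Pi.smul_apply, smul_eq_mul] at this
      change _ = (1 - (m : ℝ)) * (centredIndicator id c x.1) ^ 2
      rw [sq, ← mul_assoc, ← this, Finset.sum_mul]
      refine Finset.sum_congr rfl fun y _ => ?_
      simp only [centredIndicator, id]
      ring
    rw [card_cut_eq hk, h, sum_sum_centredIndicator_sq hk, hcard]
    ring
  apply le_antisymm
  · have hne : (Finset.univ : Finset (Fin k × Fin (m + 1) → Fin k)).Nonempty :=
      ⟨Prod.fst, Finset.mem_univ _⟩
    obtain ⟨f, -, hf⟩ := Finset.exists_mem_eq_sup _ hne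
      fun f : Fin k × Fin (m + 1) → Fin k =>
        ((Gprime k (m + 1)).edgeFinset.filter
          fun e : Sym2 (Fin k × Fin (m + 1)) => ¬ (e.map f).IsDiag).card
    rw [maxKCut, hf]
    exact hupper f
  · rw [← hattained]
    exact_mod_cast Finset.le_sup (f := fun f : Fin k × Fin (m + 1) → Fin k =>
        ((Gprime k (m + 1)).edgeFinset.filter fun e => ¬ (e.map f).IsDiag).card)
      (Finset.mem_univ Prod.fst)

theorem stmt_19 (k r : ℕ) (hk : 3 ≤ k) (hr : k + 4 ≤ r)
    (hA : ((Gprime k r).adjMatrix ℝ).IsHermitian) :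
    Finset.univ.inf'
        (Finset.univ_nonempty_iff.mpr ⟨(⟨0, by omega⟩, ⟨0, by omega⟩)⟩)
        hA.eigenvalues = 2 - (r : ℝ) ∧
    (maxKCut (Gprime k r) k : ℝ) =
      (((k : ℝ) - 1) / k) *
        (((Gprime k r).edgeFinset.card : ℝ)
          - ((k : ℝ) * r) * (2 - (r : ℝ)) / 2) := by
  obtain ⟨m, rfl⟩ : ∃ m, r = m + 1 := ⟨r - 1, by omega⟩
  have hk' : (k : ℝ) ≠ 0 := by
    have : k ≠ 0 := by omega
    exact_mod_cast this
  refine ⟨?_, ?_⟩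
  · rw [inf_eigenvalues_Gprime (by omega) (by omega) hA]
    push_cast
    ring
  · rw [maxKCut_Gprime (by omega) (by omega)]
    push_cast
    field_simp
    ring
end
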